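/- Define u : ℝ → ℝ by u(x) = −1/√(−x) for x < 0, u(x) = 1/√x for x > 0, and u(0) = 0 (so that x·u(x)² = sgn(x) for x ≠ 0). Then for every k ∈ ℝ and every nonnegative φ ∈ C_c^∞(ℝ × ℝ) with support contained in ℝ × (0,∞): ∫₀^∞∫_ℝ [ |u(x) − k| ∂_tφ(x,t) + sgn(u(x) − k)·(x·u(x)² − x·k²)·∂_xφ(x,t) − sgn(u(x) − k)·k²·φ(x,t) ] dx dt = 0. That is, the time-independent function (x,t) ↦ u(x) is a stationary, discontinuous, unbounded solution of u_t + (x u²)_x = 0 satisfying Kružkov's entropy inequality as an equality (an entropy-preserving solution). -/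

import Mathlib

open MeasureTheory Set Filter

/-- The sign function: `1` for `s ≥ 0`, `−1` for `s < 0`. -/
noncomputable def sgn (s : ℝ) : ℝ := if 0 ≤ s then 1 else -1

/-- The stationary profile `u(x) = −1/√(−x)` for `x < 0`, `1/√x` for `x > 0`, `u(0) = 0`. -/
noncomputable def uStat (x : ℝ) : ℝ :=
  if x < 0 then -1 / Real.sqrt (-x) else if 0 < x then 1 / Real.sqrt x else 0

lemma uStat_neg {x : ℝ} (h : x < 0) : uStat x = -1 / Real.sqrt (-x) := by simp [uStat, h]
lemma uStat_pos {x : ℝ} (h : 0 < x) : uStat x = 1 / Real.sqrt x := by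
  simp [uStat, h, not_lt.2 h.le]

lemma measurable_sgn : Measurable sgn :=
  Measurable.ite measurableSet_Ici measurable_const measurable_const

lemma abs_sgn (s : ℝ) : |sgn s| = 1 := by unfold sgn; split_ifs <;> simp

lemma measurable_uStat : Measurable uStat := by
  unfold uStat
  refine Measurable.ite measurableSet_Iio (by fun_prop) ?_
  exact Measurable.ite measurableSet_Ioi (by fun_prop) measurable_const

lemma x_u_sq_neg {x : ℝ} (h : x < 0) : x * uStat x ^ 2 = -1 := by
  have := h.ne
  rw [uStat_neg h, div_pow, Real.sq_sqrt (by linarith)]; field_simp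
lemma x_u_sq_pos {x : ℝ} (h : 0 < x) : x * uStat x ^ 2 = 1 := by
  rw [uStat_pos h, div_pow, Real.sq_sqrt h.le]; field_simp
lemma uStat_lt {x : ℝ} (h : x < 0) : uStat x < 0 := by
  rw [uStat_neg h]; exact div_neg_of_neg_of_pos (by norm_num) (Real.sqrt_pos.2 (by linarith))
lemma uStat_gt {x : ℝ} (h : 0 < x) : 0 < uStat x := by
  rw [uStat_pos h]; exact div_pos (by norm_num) (Real.sqrt_pos.2 (by linarith))

/-- continuous representative of the entropy flux -/
noncomputable def GG (k x : ℝ) : ℝ :=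
  if 0 ≤ k then |1 - k ^ 2 * max x 0| + k ^ 2 * min x 0
  else |1 + k ^ 2 * min x 0| - k ^ 2 * max x 0

lemma GG_cont (k : ℝ) : Continuous (GG k) := by
  unfold GG
  split_ifs <;> fun_prop

lemma GG_eq (k : ℝ) {x : ℝ} (hx : x ≠ 0) :
    sgn (uStat x - k) * (x * (uStat x) ^ 2 - x * k ^ 2) = GG k x := by
  rcases lt_or_gt_of_ne hx with h | h
  · have h1 := x_u_sq_neg h
    have h2 := uStat_lt h
    unfold GG
    rw [max_eq_right h.le, min_eq_left h.le]
    split_ifs with hk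
    · rw [sgn, if_neg (by linarith), h1]; simp; ring
    · push Not at hk
      unfold sgn
      split_ifs with h3
      · rw [h1, abs_of_nonpos]
        · ring
        · nlinarith [mul_nonneg h3 (by linarith : 0 ≤ -uStat x - k)]
      · rw [h1, abs_of_nonneg]
        · ring
        · push Not at h3
          nlinarith [mul_pos (neg_pos.2 h3) (by linarith : 0 < -uStat x - k)]
  · have h1 := x_u_sq_pos h
    have h2 := uStat_gt h
    unfold GG
    rw [max_eq_left h.le, min_eq_right h.le]
    split_ifs with hk
    · unfold sgn
      split_ifs with h3
      · rw [h1, abs_of_nonneg]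
        · ring
        · nlinarith [mul_nonneg h3 (by linarith : 0 ≤ uStat x + k)]
      · rw [h1, abs_of_nonpos]
        · ring
        · push Not at h3
          nlinarith [mul_pos (neg_pos.2 h3) (by linarith : 0 < uStat x + k)]
    · push Not at hk
      rw [sgn, if_pos (by linarith), h1]; simp; ring

lemma uStat_contAt {x : ℝ} (hx : x ≠ 0) : ContinuousAt uStat x := by
  rcases lt_or_gt_of_ne hx with h | h
  · have : uStat =ᶠ[nhds x] fun x => -1 / Real.sqrt (-x) := by
      filter_upwards [Iio_mem_nhds h] with y hy using uStat_neg hy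
    refine ContinuousAt.congr ?_ this.symm
    have : Real.sqrt (-x) ≠ 0 := (Real.sqrt_pos.2 (by linarith)).ne'
    fun_prop (disch := assumption)
  · have : uStat =ᶠ[nhds x] fun x => 1 / Real.sqrt x := by
      filter_upwards [Ioi_mem_nhds h] with y hy using uStat_pos hy
    refine ContinuousAt.congr ?_ this.symm
    have : Real.sqrt x ≠ 0 := (Real.sqrt_pos.2 (by linarith)).ne'
    fun_prop (disch := assumption)

lemma GG_deriv (k : ℝ) {x : ℝ} (hx : x ≠ 0) (hk : uStat x ≠ k) :
    HasDerivAt (GG k) (-(sgn (uStat x - k) * k ^ 2)) x := by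
  have hs : ∀ᶠ y in nhds x, sgn (uStat y - k) = sgn (uStat x - k) := by
    rcases lt_or_gt_of_ne hk with h | h
    · filter_upwards [(uStat_contAt hx).eventually (Iio_mem_nhds h)] with y hy
      have hy : uStat y < k := hy
      rw [sgn, sgn, if_neg (by linarith), if_neg (by linarith)]
    · filter_upwards [(uStat_contAt hx).eventually (Ioi_mem_nhds h)] with y hy
      have hy : k < uStat y := hy
      rw [sgn, sgn, if_pos (by linarith), if_pos (by linarith)]
  have hc : ∃ c : ℝ, ∀ᶠ y in nhds x, y ≠ 0 ∧ y * uStat y ^ 2 = c := by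
    rcases lt_or_gt_of_ne hx with h | h
    · refine ⟨-1, ?_⟩
      filter_upwards [Iio_mem_nhds h] with y hy using ⟨ne_of_lt hy, x_u_sq_neg hy⟩
    · refine ⟨1, ?_⟩
      filter_upwards [Ioi_mem_nhds h] with y hy using ⟨ne_of_gt hy, x_u_sq_pos hy⟩
  obtain ⟨c, hc⟩ := hc
  have : GG k =ᶠ[nhds x] fun y => sgn (uStat x - k) * (c - y * k ^ 2) := by
    filter_upwards [hs, hc] with y h1 h2
    rw [← GG_eq k h2.1, h1, h2.2]
  refine HasDerivAt.congr_of_eventuallyEq ?_ this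
  have := (((hasDerivAt_id x).mul_const (k ^ 2)).const_sub c).const_mul (sgn (uStat x - k))
  exact this.congr_deriv (by ring)

lemma exc_countable (k : ℝ) : ({x : ℝ | x = 0 ∨ uStat x = k}).Countable := by
  refine Set.Countable.mono (s₂ := {0, 1 / k ^ 2, -1 / k ^ 2}) ?_ (Set.toFinite _).countable
  rintro x hx
  by_cases h0 : x = 0
  · simp [h0]
  have hk : uStat x = k := hx.resolve_left h0
  rcases lt_or_gt_of_ne h0 with h | h
  · have h1 := x_u_sq_neg h
    rw [hk] at h1
    have : k ≠ 0 := by rintro rfl; simp at h1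
    right; right
    simp only [mem_singleton_iff]
    field_simp; linarith
  · have h1 := x_u_sq_pos h
    rw [hk] at h1
    have : k ≠ 0 := by rintro rfl; simp at h1
    right; left
    field_simp; linarith

lemma uStat_bound (x : ℝ) : |uStat x| ≤ |x ^ (-(1/2) : ℝ)| + |(-x) ^ (-(1/2) : ℝ)| := by
  rcases lt_trichotomy x 0 with h | h | h
  · rw [uStat_neg h, Real.sqrt_eq_rpow, Real.rpow_neg (x := -x) (by linarith)]
    simp [abs_div, neg_div]
  · subst h; simp [uStat]
  · rw [uStat_pos h, Real.sqrt_eq_rpow, Real.rpow_neg (x := x) (by linarith)]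
    simp [abs_div]

lemma uStat_int {R : ℝ} (hR : 0 < R) : IntegrableOn uStat (Ioc (-R) R) := by
  have h1 : IntervalIntegrable (fun x : ℝ => x ^ (-(1/2) : ℝ)) volume (-R) R :=
    intervalIntegral.intervalIntegrable_rpow' (by norm_num)
  have h2 : IntervalIntegrable (fun x : ℝ => (-x) ^ (-(1/2) : ℝ)) volume (-R) R := by
    have := (intervalIntegral.intervalIntegrable_rpow' (a := R) (b := -R)
      (r := -(1/2)) (by norm_num)).comp_sub_left 0
    simpa using this
  rw [intervalIntegrable_iff_integrableOn_Ioc_of_le (by linarith)] at h1 h2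
  refine Integrable.mono' (h1.abs.add h2.abs) measurable_uStat.aestronglyMeasurable ?_
  exact Eventually.of_forall fun x => uStat_bound x

/-- the time-independent function `(x,t) ↦ uStat x` is a stationary,
discontinuous, unbounded solution of `u_t + (x u²)_x = 0` satisfying Kružkov's entropy
inequality as an *equality*: for every `k ∈ ℝ` and every nonnegative smooth compactly
supported test function supported in `ℝ × (0,∞)`, the Kružkov integral vanishes. -/
theorem statement7 (k : ℝ) (φ : ℝ × ℝ → ℝ) (hφ : ContDiff ℝ (⊤ : ℕ∞) φ)
    (hφc : HasCompactSupport φ) (hφpos : ∀ p, 0 ≤ φ p)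
    (hφsupp : tsupport φ ⊆ univ ×ˢ Ioi 0) :
    (∫ t in Ioi (0 : ℝ), ∫ x : ℝ,
      (|uStat x - k| * fderiv ℝ φ (x, t) (0, 1)
        + sgn (uStat x - k) * (x * (uStat x) ^ 2 - x * k ^ 2) * fderiv ℝ φ (x, t) (1, 0)
        - sgn (uStat x - k) * k ^ 2 * φ (x, t))) = 0 := by
  obtain ⟨R, hR, hball⟩ := hφc.isCompact.isBounded.subset_ball_lt 0 0
  have hz : ∀ p : ℝ × ℝ, (R ≤ |p.1| ∨ R ≤ |p.2|) → p ∉ tsupport φ := by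
    intro p hp hmem
    have := hball hmem
    rw [mem_ball_zero_iff, Prod.norm_def, max_lt_iff, Real.norm_eq_abs, Real.norm_eq_abs] at this
    rcases hp with h | h <;> linarith [this.1, this.2]
  have hφ0 : ∀ p : ℝ × ℝ, p ∉ tsupport φ → φ p = 0 := fun p => image_eq_zero_of_notMem_tsupport
  have hd0 : ∀ p : ℝ × ℝ, p ∉ tsupport φ → fderiv ℝ φ p = 0 := fun p hp =>
    image_eq_zero_of_notMem_tsupport fun h => hp (tsupport_fderiv_subset ℝ h)
  have hdc : Continuous (fderiv ℝ φ) := hφ.continuous_fderiv (by simp)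
  have hdiff : Differentiable ℝ φ := hφ.differentiable (by simp)
  have hdcs : HasCompactSupport (fderiv ℝ φ) := hφc.fderiv ℝ
  have hfc : Continuous φ := hφ.continuous
  obtain ⟨C, hC⟩ := hdcs.exists_bound_of_continuous hdc
  have hC0 : 0 ≤ C := (norm_nonneg _).trans (hC 0)
  have hu : IntegrableOn (fun x => |uStat x - k|) (Ioc (-R) R) :=
    ((uStat_int hR).sub (integrable_const k)).abs
  -- domination
  have hdt : ∀ x t, |fderiv ℝ φ (x, t) (0, 1)| ≤
      (Ioc (-R) R).indicator (fun _ => 1) x * (Ioc (-R) R).indicator (fun _ => C) t := by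
    intro x t
    by_cases hx : R ≤ |x| ∨ R ≤ |t|
    · rw [hd0 _ (hz (x, t) hx)]
      simp only [ContinuousLinearMap.zero_apply, abs_zero]
      exact mul_nonneg (indicator_nonneg (fun _ _ => zero_le_one) _)
        (indicator_nonneg (fun _ _ => hC0) _)
    · push Not at hx
      have m1 : x ∈ Ioc (-R) R := ⟨(abs_lt.1 hx.1).1, (abs_lt.1 hx.1).2.le⟩
      have m2 : t ∈ Ioc (-R) R := ⟨(abs_lt.1 hx.2).1, (abs_lt.1 hx.2).2.le⟩
      rw [indicator_of_mem m1, indicator_of_mem m2, one_mul]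
      have := (fderiv ℝ φ (x, t)).le_opNorm (0, 1)
      have h1 : ‖((0, 1) : ℝ × ℝ)‖ = 1 := by simp [Prod.norm_def]
      rw [h1, mul_one, Real.norm_eq_abs] at this
      exact this.trans (hC _)
  have hui : Integrable ((Ioc (-R) R).indicator (fun x => |uStat x - k|)) :=
    hu.integrable_indicator measurableSet_Ioc
  have hCi : Integrable ((Ioc (-R) R).indicator (fun _ : ℝ => C)) :=
    (integrableOn_const (by simp)).integrable_indicator measurableSet_Ioc
  have hmA : Measurable (fun p : ℝ × ℝ => |uStat p.2 - k| * fderiv ℝ φ (p.2, p.1) (0, 1)) := by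
    have : Measurable (fun p : ℝ × ℝ => fderiv ℝ φ (p.2, p.1) (0, 1)) := by
      apply Continuous.measurable; fun_prop
    have h2 : Measurable (fun p : ℝ × ℝ => uStat p.2) := measurable_uStat.comp measurable_snd
    have h3 : Measurable (fun p : ℝ × ℝ => |uStat p.2 - k|) :=
      continuous_abs.measurable.comp (h2.sub_const k)
    exact h3.mul this
  have hAb : ∀ x t, ‖|uStat x - k| * fderiv ℝ φ (x, t) (0, 1)‖ ≤
      (Ioc (-R) R).indicator (fun _ => C) t
        * (Ioc (-R) R).indicator (fun x => |uStat x - k|) x := by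
    intro x t
    rw [norm_mul, Real.norm_eq_abs, Real.norm_eq_abs, abs_abs]
    refine (mul_le_mul_of_nonneg_left (hdt x t) (abs_nonneg _)).trans (le_of_eq ?_)
    by_cases hx : x ∈ Ioc (-R) R
    · simp only [indicator_of_mem hx]; ring
    · simp only [indicator_of_notMem hx]; ring
  have hAint : Integrable
      (fun p : ℝ × ℝ => |uStat p.2 - k| * fderiv ℝ φ (p.2, p.1) (0, 1))
      ((volume.restrict (Ioi (0:ℝ))).prod volume) := by
    refine Integrable.mono' (hCi.restrict.mul_prod hui) hmA.aestronglyMeasurable ?_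
    exact Eventually.of_forall fun p => hAb p.2 p.1
  have hA1 : ∀ t, Integrable (fun x => |uStat x - k| * fderiv ℝ φ (x, t) (0, 1)) := by
    intro t
    refine Integrable.mono' (hui.const_mul ((Ioc (-R) R).indicator (fun _ => C) t))
      (hmA.comp (measurable_const.prodMk measurable_id)).aestronglyMeasurable ?_
    exact Eventually.of_forall fun x => hAb x t
  -- spatial part
  have hB : ∀ t, Integrable (fun x =>
      sgn (uStat x - k) * (x * (uStat x) ^ 2 - x * k ^ 2) * fderiv ℝ φ (x, t) (1, 0)
        - sgn (uStat x - k) * k ^ 2 * φ (x, t)) ∧ ∫ x,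
      (sgn (uStat x - k) * (x * (uStat x) ^ 2 - x * k ^ 2) * fderiv ℝ φ (x, t) (1, 0)
        - sgn (uStat x - k) * k ^ 2 * φ (x, t)) = 0 := by
    intro t
    have hae : (fun x =>
      sgn (uStat x - k) * (x * (uStat x) ^ 2 - x * k ^ 2) * fderiv ℝ φ (x, t) (1, 0)
        - sgn (uStat x - k) * k ^ 2 * φ (x, t)) =ᵐ[volume] fun x =>
        (-(sgn (uStat x - k) * k ^ 2)) * φ (x, t) + GG k x * fderiv ℝ φ (x, t) (1, 0) := by
      have : ∀ᵐ x : ℝ, x ≠ 0 := by simp [ae_iff]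
      filter_upwards [this] with x hx
      rw [GG_eq k hx]; ring
    have cs1 : HasCompactSupport (fun x => φ (x, t)) :=
      HasCompactSupport.intro (isCompact_Icc (a := -R) (b := R)) fun x hx =>
        hφ0 _ (hz _ (Or.inl (by
          by_contra h
          push Not at h
          exact hx ⟨(abs_lt.1 h).1.le, (abs_lt.1 h).2.le⟩)))
    have cs2 : HasCompactSupport (fun x => GG k x * fderiv ℝ φ (x, t) (1, 0)) :=
      HasCompactSupport.intro (isCompact_Icc (a := -R) (b := R)) fun x hx => by
        rw [hd0 _ (hz _ (Or.inl (by
          by_contra h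
          push Not at h
          exact hx ⟨(abs_lt.1 h).1.le, (abs_lt.1 h).2.le⟩)))]
        simp
    have hGc := GG_cont k
    have i1 : Integrable (fun x => φ (x, t)) :=
      Continuous.integrable_of_hasCompactSupport (by fun_prop) cs1
    have i2 : Integrable (fun x => GG k x * fderiv ℝ φ (x, t) (1, 0)) :=
      Continuous.integrable_of_hasCompactSupport (by fun_prop) cs2
    have i3 : Integrable (fun x => (-(sgn (uStat x - k) * k ^ 2)) * φ (x, t)) := by
      refine i1.bdd_mul (c := k ^ 2) ?_ ?_
      · exact ((measurable_sgn.comp (measurable_uStat.sub_const k)).mul_const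
          _).neg.aestronglyMeasurable
      · refine Eventually.of_forall fun x => ?_
        rw [norm_neg, norm_mul, Real.norm_eq_abs, abs_sgn, one_mul, Real.norm_eq_abs, abs_sq]
    have i4 := i3.add i2
    refine ⟨i4.congr hae.symm, ?_⟩
    rw [integral_congr_ae hae]
    have hint : ∫ x in (-R)..R,
        ((-(sgn (uStat x - k) * k ^ 2)) * φ (x, t) + GG k x * fderiv ℝ φ (x, t) (1, 0))
        = GG k R * φ (R, t) - GG k (-R) * φ (-R, t) := by
      refine integral_eq_of_hasDerivAt_off_countable_of_le
        (fun x => GG k x * φ (x, t)) _ (by linarith) (exc_countable k) ?_ ?_ ?_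
      · exact Continuous.continuousOn (by fun_prop)
      · intro x hx
        have hx2 : ¬ (x = 0 ∨ uStat x = k) := hx.2
        push Not at hx2
        refine (GG_deriv k hx2.1 hx2.2).mul ?_
        exact (hdiff (x, t)).hasFDerivAt.comp_hasDerivAt x
          ((hasDerivAt_id x).prodMk (hasDerivAt_const x t))
      · exact i4.intervalIntegrable
    rw [hφ0 _ (hz (R, t) (Or.inl (le_abs_self R))),
      hφ0 _ (hz (-R, t) (Or.inl (by rw [abs_neg]; exact le_abs_self R)))] at hint
    rw [intervalIntegral.integral_of_le (by linarith)] at hint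
    rw [← setIntegral_eq_integral_of_forall_compl_eq_zero (s := Ioc (-R) R), hint]
    · simp
    · intro x hx
      have hx' := hz (x, t) (Or.inl (by
          by_contra h
          push Not at h
          exact hx ⟨(abs_lt.1 h).1, (abs_lt.1 h).2.le⟩))
      rw [hφ0 _ hx', hd0 _ hx']; simp
  have hinner : ∀ t, (∫ x : ℝ,
      (|uStat x - k| * fderiv ℝ φ (x, t) (0, 1)
        + sgn (uStat x - k) * (x * (uStat x) ^ 2 - x * k ^ 2) * fderiv ℝ φ (x, t) (1, 0)
        - sgn (uStat x - k) * k ^ 2 * φ (x, t)))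
      = ∫ x : ℝ, |uStat x - k| * fderiv ℝ φ (x, t) (0, 1) := by
    intro t
    simp_rw [add_sub_assoc]
    rw [integral_add (hA1 t) (hB t).1, (hB t).2, add_zero]
  simp_rw [hinner]
  rw [integral_integral_swap hAint]
  refine integral_eq_zero_of_ae (Eventually.of_forall fun x => ?_)
  simp only [Pi.zero_apply]
  rw [integral_const_mul]
  have hder : ∀ t, HasDerivAt (fun t => φ (x, t)) (fderiv ℝ φ (x, t) (0, 1)) t := fun t =>
    (hdiff (x, t)).hasFDerivAt.comp_hasDerivAt t
      ((hasDerivAt_const t x).prodMk (hasDerivAt_id t))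
  have cs : HasCompactSupport (fun t => φ (x, t)) :=
    HasCompactSupport.intro (isCompact_Icc (a := -R) (b := R)) fun t ht =>
      hφ0 _ (hz _ (Or.inr (by
        by_contra h
        push Not at h
        exact ht ⟨(abs_lt.1 h).1.le, (abs_lt.1 h).2.le⟩)))
  have c1 : ContDiff ℝ 1 (fun t => φ (x, t)) :=
    (hφ.of_le (by exact_mod_cast le_top)).comp (contDiff_const.prodMk contDiff_id)
  have := cs.integral_Ioi_deriv_eq c1 0
  have h0 : φ (x, 0) = 0 := hφ0 _ fun h => by simpa using hφsupp h
  rw [show deriv (fun t => φ (x, t)) = fun t => fderiv ℝ φ (x, t) (0, 1) from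
    funext fun t => (hder t).deriv] at this
  rw [this, h0]; simp
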